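/- For the distributed gradient-tracking algorithm with each f_i β-smooth and with x* a point where ∇f(x*) = 0, the iterates satisfy, for every k ≥ 1: ‖x(k) − x(k−1)‖ ≤ η ‖s(k−1) − 𝟙g(k−1)‖ + (ηβ + 2) ‖x(k−1) − 𝟙x̄(k−1)‖ + ηβ√n ‖x̄(k−1) − x*‖. -/

import Mathlib

open scoped BigOperators RealInnerProductSpace
open Filter

noncomputable section

abbrev Vec (N : ℕ) := EuclideanSpace ℝ (Fin N)

/-- Frobenius norm of a stacked matrix in `ℝ^{n×N}`, viewed as `n` rows in `ℝ^N`. -/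
def fro {n N : ℕ} (A : Fin n → Vec N) : ℝ := Real.sqrt (∑ i, ‖A i‖ ^ 2)

theorem fro_eq_norm_toLp {n N : ℕ} (A : Fin n → Vec N) : fro A = ‖WithLp.toLp 2 A‖ := by
  rw [PiLp.norm_eq_of_L2, fro]

theorem fro_add_le {n N : ℕ} (A B : Fin n → Vec N) : fro (A + B) ≤ fro A + fro B := by
  simpa only [fro_eq_norm_toLp, WithLp.toLp_add] using norm_add_le _ _

theorem fro_smul {n N : ℕ} (c : ℝ) (A : Fin n → Vec N) : fro (c • A) = |c| * fro A := by
  simp only [fro_eq_norm_toLp, WithLp.toLp_smul, norm_smul, Real.norm_eq_abs]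

theorem fro_neg {n N : ℕ} (A : Fin n → Vec N) : fro (-A) = fro A := by
  simp [fro]

theorem fro_const {n N : ℕ} (v : Vec N) : fro (fun _ : Fin n => v) = √n * ‖v‖ := by
  simp [fro]

/-- Mixing the rows by a doubly stochastic matrix does not increase the Frobenius norm. -/
theorem fro_doublyStochastic_le {n N : ℕ} {W : Matrix (Fin n) (Fin n) ℝ}
    (hWnonneg : ∀ i j, 0 ≤ W i j) (hWrow : ∀ i, ∑ j, W i j = 1) (hWcol : ∀ j, ∑ i, W i j = 1)
    (A : Fin n → Vec N) : fro (fun i => ∑ j, W i j • A j) ≤ fro A := by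
  refine Real.sqrt_le_sqrt ?_
  calc ∑ i, ‖∑ j, W i j • A j‖ ^ 2 ≤ ∑ i, ∑ j, W i j * ‖A j‖ ^ 2 := by
        refine Finset.sum_le_sum fun i _ => ?_
        have h : ‖∑ j, W i j • A j‖ ≤ ∑ j, W i j * ‖A j‖ :=
          (norm_sum_le _ _).trans_eq <| Finset.sum_congr rfl fun j _ => by
            rw [norm_smul, Real.norm_of_nonneg (hWnonneg i j)]
        exact (pow_le_pow_left₀ (norm_nonneg _) h 2).trans <|
          Real.pow_arith_mean_le_arith_mean_pow _ _ _ (fun j _ => hWnonneg i j) (hWrow i)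
            (fun j _ => norm_nonneg _) 2
    _ = ∑ j, ‖A j‖ ^ 2 := by
        rw [Finset.sum_comm]
        simp only [← Finset.sum_mul, hWcol, one_mul]

theorem sum_norm_le_sqrt_mul_fro {n N : ℕ} (A : Fin n → Vec N) :
    ∑ i, ‖A i‖ ≤ √n * fro A := by
  rw [fro, ← Real.sqrt_mul n.cast_nonneg]
  refine Real.le_sqrt_of_sq_le ?_
  simpa using sq_sum_le_card_mul_sum_sq (s := Finset.univ) (f := fun i => ‖A i‖)

theorem gradient_average {n N : ℕ} {f : Fin n → Vec N → ℝ}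
    (hdiff : ∀ i, Differentiable ℝ (f i)) (c : ℝ) (z : Vec N) :
    gradient (fun z => c * ∑ i, f i z) z = c • ∑ i, gradient (f i) z := by
  refine HasGradientAt.gradient ?_
  rw [hasGradientAt_iff_hasFDerivAt, map_smul, map_sum]
  exact (HasFDerivAt.fun_sum fun i _ =>
    ((hdiff i z).hasGradientAt).hasFDerivAt).const_mul c

/-- The averaged gradient is controlled by the consensus error and the distance from a
stationary point. -/
theorem sqrt_mul_norm_average_gradient_le {n N : ℕ} (hn : 0 < n) {β : ℝ} (hβ : 0 ≤ β)
    {G : Fin n → Vec N → Vec N} (hG : ∀ i u v, ‖G i u - G i v‖ ≤ β * ‖u - v‖)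
    {z : Vec N} (hz : (n : ℝ)⁻¹ • ∑ i, G i z = 0) (x : Fin n → Vec N) (y : Vec N) :
    √n * ‖(n : ℝ)⁻¹ • ∑ i, G i (x i)‖ ≤
      β * fro (fun i => x i - y) + β * √n * ‖y - z‖ := by
  have hn' : (0 : ℝ) < n := by exact_mod_cast hn
  have hsum : ‖∑ i, (G i (x i) - G i z)‖ ≤ β * (√n * fro (fun i => x i - y)) + n * (β * ‖y - z‖) :=
    calc ‖∑ i, (G i (x i) - G i z)‖ ≤ ∑ i, (β * ‖x i - y‖ + β * ‖y - z‖) := by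
          refine norm_sum_le_of_le _ fun i _ => (hG i _ _).trans ?_
          rw [← mul_add]
          exact mul_le_mul_of_nonneg_left (norm_sub_le_norm_sub_add_norm_sub _ _ _) hβ
      _ = β * ∑ i, ‖x i - y‖ + n * (β * ‖y - z‖) := by
          simp [Finset.sum_add_distrib, Finset.mul_sum]
      _ ≤ _ := by
          gcongr
          exact sum_norm_le_sqrt_mul_fro fun i => x i - y
  have heq : (n : ℝ)⁻¹ • ∑ i, G i (x i) = (n : ℝ)⁻¹ • ∑ i, (G i (x i) - G i z) := by
    rw [Finset.sum_sub_distrib, smul_sub, hz, sub_zero]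
  rw [heq, norm_smul, Real.norm_of_nonneg (inv_nonneg.2 hn'.le)]
  calc √n * ((n : ℝ)⁻¹ * ‖∑ i, (G i (x i) - G i z)‖)
      ≤ √n * ((n : ℝ)⁻¹ * (β * (√n * fro (fun i => x i - y)) + n * (β * ‖y - z‖))) := by gcongr
    _ = (√n * √n) * (n : ℝ)⁻¹ * (β * fro (fun i => x i - y))
        + n * (n : ℝ)⁻¹ * (β * √n * ‖y - z‖) := by ring
    _ = _ := by rw [Real.mul_self_sqrt hn'.le, mul_inv_cancel₀ hn'.ne', one_mul, one_mul]

theorem statement8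
    {n N : ℕ} (hn : 0 < n)
    (β : ℝ)
    (f : Fin n → Vec N → ℝ)
    (hdiff : ∀ i, Differentiable ℝ (f i))
    (hsmooth : ∀ i, ∀ u v : Vec N,
      ‖gradient (f i) u - gradient (f i) v‖ ≤ β * ‖u - v‖)
    (favg : Vec N → ℝ) (hfavg : ∀ z, favg z = (n : ℝ)⁻¹ * ∑ i, f i z)
    (xstar : Vec N) (hstar : gradient favg xstar = 0)
    (W : Matrix (Fin n) (Fin n) ℝ)
    (hWnonneg : ∀ i j, 0 ≤ W i j)
    (hWrow : ∀ i, ∑ j, W i j = 1)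
    (hWcol : ∀ j, ∑ i, W i j = 1)
    (η : ℝ) (hη : 0 < η)
    (x s : ℕ → Fin n → Vec N)
    (hs0 : ∀ i, s 0 i = gradient (f i) (x 0 i))
    (hxupd : ∀ t i, x (t + 1) i = (∑ j, W i j • x t j) - η • s t i)
    (hsupd : ∀ t i, s (t + 1) i =
      (∑ j, W i j • s t j) + gradient (f i) (x (t + 1) i) - gradient (f i) (x t i))
    (xbar g : ℕ → Vec N)
    (hxbar : ∀ t, xbar t = (n : ℝ)⁻¹ • ∑ i, x t i)
    (hg : ∀ t, g t = (n : ℝ)⁻¹ • ∑ i, gradient (f i) (x t i)) :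
    ∀ k : ℕ,
      fro (fun i => x (k + 1) i - x k i) ≤
        η * fro (fun i => s k i - g k) +
          (η * β + 2) * fro (fun i => x k i - xbar k) +
          η * β * Real.sqrt n * ‖xbar k - xstar‖ := by
  intro k
  rcases lt_or_ge β 0 with hβ | hβ
  · have : Subsingleton (Vec N) := ⟨fun u v => by
      by_contra huv
      exact absurd ((norm_nonneg _).trans (hsmooth ⟨0, hn⟩ u v))
        (not_le.2 (mul_neg_of_neg_of_pos hβ (norm_pos_iff.2 (sub_ne_zero.2 huv))))⟩
    have hfro : ∀ A : Fin n → Vec N, fro A = 0 := fun A => by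
      simp [fro, Subsingleton.elim (A _) 0]
    simp [hfro, Subsingleton.elim (xbar k) xstar]
  have hgrad : (n : ℝ)⁻¹ • ∑ i, gradient (f i) xstar = 0 := by
    rw [← gradient_average hdiff, ← funext hfavg, hstar]
  have hgk := sqrt_mul_norm_average_gradient_le hn hβ hsmooth hgrad (x k) (xbar k)
  rw [← hg, ← fro_const] at hgk
  set y : Fin n → Vec N := fun i => x k i - xbar k with hy
  have hmix := fro_doublyStochastic_le hWnonneg hWrow hWcol y
  have hstep : (fun i => x (k + 1) i - x k i) =
      ((fun i => ∑ j, W i j • y j) + -y) +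
        -(η • ((fun i => s k i - g k) + fun _ => g k)) := by
    funext i
    simp only [hy, hxupd, Pi.add_apply, Pi.neg_apply, Pi.smul_apply, smul_sub,
      Finset.sum_sub_distrib, ← Finset.sum_smul, hWrow, one_smul, sub_add_cancel]
    abel
  have hmixed := fro_add_le (fun i => ∑ j, W i j • y j) (-y)
  have htrack := mul_le_mul_of_nonneg_left
    (fro_add_le (fun i => s k i - g k) (fun _ => g k)) hη.le
  have htotal := fro_add_le ((fun i => ∑ j, W i j • y j) + -y)
    (-(η • ((fun i => s k i - g k) + fun _ => g k)))
  rw [fro_neg, fro_smul, abs_of_pos hη] at htotal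
  rw [fro_neg] at hmixed
  rw [hstep]
  linarith [mul_le_mul_of_nonneg_left hgk hη.le]
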